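/- Let M ≥ 1, K ≥ 1, let μ₁,…,μ_M ∈ ℝ, σ₁,…,σ_M > 0, and let f₀(y) = Σ_{i=1}^K p_i t_{μ_{0,i},σ_{0,i},ν}(y) be a finite mixture of Student t densities with common degrees of freedom ν > 2, locations μ_{0,i} ∈ ℝ, scales σ_{0,i} > 0, and (p₁,…,p_K) ∈ Δ_K. Then for every ω* in the interior of Δ_M, with h(y|ω*) = Σ_{m=1}^M ω*_m φ(y|μ_m,σ_m²) and H(y|ω*) = Σ_{m=1}^M ω*_m Φ(y|μ_m,σ_m²), one has ∫_ℝ [|log(H(y|ω*))| + |log(1−H(y|ω*))|] f₀(y) dy < +∞ and KL(f₀, h(·|ω*)) < +∞. -/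

import Mathlib

open MeasureTheory Set

/-- Density `φ(y|μ,σ²)` of the normal distribution with mean `μ` and variance `σ2`. -/
noncomputable def gaussDensity (μ σ2 y : ℝ) : ℝ :=
  (Real.sqrt (2 * Real.pi * σ2))⁻¹ * Real.exp (-((y - μ) ^ 2) / (2 * σ2))

/-- Cdf `Φ(y|μ,σ²)` of the normal distribution with mean `μ` and variance `σ2`. -/
noncomputable def gaussCdf (μ σ2 y : ℝ) : ℝ := ∫ z in Iic y, gaussDensity μ σ2 z

/-- Student t density with location `μ`, scale `σ` and `ν` degrees of freedom. -/
noncomputable def studentT (μ σ ν y : ℝ) : ℝ :=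
  (Real.Gamma ((ν + 1) / 2) / (Real.Gamma (ν / 2) * Real.sqrt (ν * Real.pi) * σ)) *
    (1 + ((y - μ) / σ) ^ 2 / ν) ^ (-((ν + 1) / 2))

/-- A function bounded below by `exp (-(C * (1 + y ^ 2)))` for some `C`. -/
def HasGaussianLowerBound (g : ℝ → ℝ) : Prop :=
  ∃ C : ℝ, ∀ y, Real.exp (-(C * (1 + y ^ 2))) ≤ g y

namespace HasGaussianLowerBound

theorem mono {g k : ℝ → ℝ} (hg : HasGaussianLowerBound g) (h : ∀ y, g y ≤ k y) :
    HasGaussianLowerBound k := by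
  obtain ⟨C, hC⟩ := hg
  exact ⟨C, fun y => (hC y).trans (h y)⟩

theorem const {a : ℝ} (ha : 0 < a) : HasGaussianLowerBound fun _ => a := by
  refine ⟨|Real.log a|, fun y => ?_⟩
  rw [← Real.le_log_iff_exp_le ha]
  nlinarith [neg_abs_le (Real.log a), mul_nonneg (abs_nonneg (Real.log a)) (sq_nonneg y)]

theorem mul {g k : ℝ → ℝ} (hg : HasGaussianLowerBound g) (hk : HasGaussianLowerBound k) :
    HasGaussianLowerBound fun y => g y * k y := by
  obtain ⟨C, hC⟩ := hg
  obtain ⟨D, hD⟩ := hk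
  refine ⟨C + D, fun y => ?_⟩
  have : -((C + D) * (1 + y ^ 2)) = -(C * (1 + y ^ 2)) + -(D * (1 + y ^ 2)) := by ring
  rw [this, Real.exp_add]
  exact mul_le_mul (hC y) (hD y) (Real.exp_pos _).le ((Real.exp_pos _).le.trans (hC y))

theorem exp_neg_sq (μ : ℝ) {b : ℝ} (hb : 0 ≤ b) :
    HasGaussianLowerBound fun y => Real.exp (-(b * (y - μ) ^ 2)) := by
  refine ⟨b * (2 + 2 * μ ^ 2), fun y => Real.exp_le_exp.2 (neg_le_neg ?_)⟩
  rw [mul_assoc]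
  refine mul_le_mul_of_nonneg_left ?_ hb
  nlinarith [sq_nonneg (y + μ), mul_nonneg (sq_nonneg μ) (sq_nonneg y)]

theorem weighted_sum {ι : Type*} [Fintype ι] {w : ι → ℝ} {g : ι → ℝ → ℝ}
    (hw : ∀ i, 0 ≤ w i) (hg : ∀ i y, 0 ≤ g i y) {j : ι} (hj : 0 < w j)
    (h : HasGaussianLowerBound (g j)) : HasGaussianLowerBound fun y => ∑ i, w i * g i y :=
  ((const hj).mul h).mono fun y =>
    Finset.single_le_sum (f := fun i => w i * g i y)
      (fun i _ => mul_nonneg (hw i) (hg i y)) (Finset.mem_univ j)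

theorem pos {g : ℝ → ℝ} (hg : HasGaussianLowerBound g) (y : ℝ) : 0 < g y := by
  obtain ⟨C, hC⟩ := hg
  exact (Real.exp_pos _).trans_le (hC y)

theorem exists_abs_log_le {g : ℝ → ℝ} (hg : HasGaussianLowerBound g) {B : ℝ}
    (hB : ∀ y, g y ≤ B) : ∃ A : ℝ, ∀ y, |Real.log (g y)| ≤ A * (1 + y ^ 2) := by
  have hpos := hg.pos
  obtain ⟨C, hC⟩ := hg
  refine ⟨max C |Real.log B|, fun y => ?_⟩
  have hy : (0 : ℝ) ≤ 1 + y ^ 2 := by positivity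
  have h1 := (Real.le_log_iff_exp_le (hpos y)).2 (hC y)
  have h2 := (Real.log_le_log (hpos y) (hB y)).trans (le_abs_self _)
  have h3 := mul_le_mul_of_nonneg_right (le_max_left C |Real.log B|) hy
  have h4 := mul_le_mul_of_nonneg_right (le_max_right C |Real.log B|) hy
  have h5 := mul_nonneg (abs_nonneg (Real.log B)) (sq_nonneg y)
  rw [abs_le]
  constructor <;> linarith

/-- Integrals over sets containing an interval of length one next to `y` inherit the bound. -/
theorem setIntegral {g : ℝ → ℝ} (hg : HasGaussianLowerBound g) (hi : Integrable g)
    {s : ℝ → Set ℝ} {a : ℝ → ℝ} (ha : ∀ y, y - 1 ≤ a y ∧ a y ≤ y)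
    (hs : ∀ y, Ioc (a y) (a y + 1) ⊆ s y) :
    HasGaussianLowerBound fun y => ∫ z in s y, g z := by
  have hpos := hg.pos
  obtain ⟨C, hC⟩ := hg
  refine ⟨3 * |C|, fun y => ?_⟩
  calc Real.exp (-(3 * |C| * (1 + y ^ 2)))
      = ∫ _ in Ioc (a y) (a y + 1), Real.exp (-(3 * |C| * (1 + y ^ 2))) := by simp
    _ ≤ ∫ z in Ioc (a y) (a y + 1), g z := by
      refine setIntegral_mono_on (by simp) hi.integrableOn measurableSet_Ioc fun z hz => ?_
      refine le_trans (Real.exp_le_exp.2 (neg_le_neg ?_)) (hC z)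
      have hzy : |z - y| ≤ 1 := abs_le.2 ⟨by linarith [hz.1, (ha y).1], by
        linarith [hz.2, (ha y).2]⟩
      have hz2 : 1 + z ^ 2 ≤ 3 * (1 + y ^ 2) := by
        have := sq_le_one_iff_abs_le_one (z - y) |>.2 hzy
        nlinarith [sq_nonneg (z - 2 * y)]
      have h0 : (0 : ℝ) ≤ 1 + z ^ 2 := by positivity
      calc C * (1 + z ^ 2) ≤ |C| * (1 + z ^ 2) := mul_le_mul_of_nonneg_right (le_abs_self C) h0
        _ ≤ |C| * (3 * (1 + y ^ 2)) := mul_le_mul_of_nonneg_left hz2 (abs_nonneg C)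
        _ = 3 * |C| * (1 + y ^ 2) := by ring
    _ ≤ ∫ z in s y, g z :=
      setIntegral_mono_set hi.integrableOn (ae_of_all _ fun z => (hpos z).le)
        (hs y).eventuallyLE

end HasGaussianLowerBound

section Gaussian

variable {μ σ2 : ℝ}

theorem gaussDensity_eq_gaussianPDFReal (h : 0 ≤ σ2) :
    gaussDensity μ σ2 = ProbabilityTheory.gaussianPDFReal μ ⟨σ2, h⟩ := rfl

theorem integrable_gaussDensity (h : 0 ≤ σ2) : Integrable (gaussDensity μ σ2) := by
  rw [gaussDensity_eq_gaussianPDFReal h]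
  exact ProbabilityTheory.integrable_gaussianPDFReal _ _

theorem measurable_gaussDensity : Measurable (gaussDensity μ σ2) := by
  unfold gaussDensity
  fun_prop

theorem gaussDensity_nonneg (y : ℝ) : 0 ≤ gaussDensity μ σ2 y := by
  unfold gaussDensity
  positivity

theorem gaussDensity_le (h : 0 ≤ σ2) (y : ℝ) :
    gaussDensity μ σ2 y ≤ (Real.sqrt (2 * Real.pi * σ2))⁻¹ := by
  unfold gaussDensity
  refine mul_le_of_le_one_right (by positivity) (Real.exp_le_one_iff.2 ?_)
  rw [neg_div]
  exact neg_nonpos.2 (by positivity)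

theorem integral_gaussDensity (h : 0 < σ2) : ∫ y, gaussDensity μ σ2 y = 1 := by
  rw [gaussDensity_eq_gaussianPDFReal h.le]
  refine ProbabilityTheory.integral_gaussianPDFReal_eq_one _ fun h0 => ?_
  exact h.ne' (congrArg NNReal.toReal h0)

theorem one_sub_gaussCdf (h : 0 < σ2) (y : ℝ) :
    1 - gaussCdf μ σ2 y = ∫ z in Ioi y, gaussDensity μ σ2 z := by
  rw [← integral_gaussDensity (μ := μ) h,
    ← integral_add_compl measurableSet_Iic (integrable_gaussDensity h.le) (s := Iic y), compl_Iic]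
  simp [gaussCdf]

theorem gaussCdf_nonneg (y : ℝ) : 0 ≤ gaussCdf μ σ2 y :=
  integral_nonneg fun _ => gaussDensity_nonneg _

theorem gaussCdf_le_one (h : 0 < σ2) (y : ℝ) : gaussCdf μ σ2 y ≤ 1 := by
  rw [← sub_nonneg, one_sub_gaussCdf h]
  exact integral_nonneg fun _ => gaussDensity_nonneg _

theorem measurable_gaussCdf (h : 0 ≤ σ2) : Measurable (gaussCdf μ σ2) := by
  refine Monotone.measurable fun a b hab => ?_
  exact setIntegral_mono_set (integrable_gaussDensity h).integrableOn
    (ae_of_all _ fun _ => gaussDensity_nonneg _) (Iic_subset_Iic.2 hab).eventuallyLE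

theorem hasGaussianLowerBound_gaussDensity (h : 0 < σ2) :
    HasGaussianLowerBound (gaussDensity μ σ2) := by
  have hc : 0 < (Real.sqrt (2 * Real.pi * σ2))⁻¹ := by positivity
  refine ((HasGaussianLowerBound.const hc).mul
    (.exp_neg_sq μ (b := (2 * σ2)⁻¹) (by positivity))).mono fun y => le_of_eq ?_
  simp only [gaussDensity]
  congr 2
  ring

theorem hasGaussianLowerBound_gaussCdf (h : 0 < σ2) :
    HasGaussianLowerBound (gaussCdf μ σ2) :=
  (hasGaussianLowerBound_gaussDensity h).setIntegral (integrable_gaussDensity h.le)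
    (a := fun y => y - 1) (fun y => ⟨le_rfl, by linarith⟩)
    (fun y z hz => by simpa using hz.2)

theorem hasGaussianLowerBound_one_sub_gaussCdf (h : 0 < σ2) :
    HasGaussianLowerBound fun y => 1 - gaussCdf μ σ2 y := by
  simp only [one_sub_gaussCdf h]
  exact (hasGaussianLowerBound_gaussDensity h).setIntegral (integrable_gaussDensity h.le)
    (a := fun y => y) (fun y => ⟨by linarith, le_rfl⟩) (fun y z hz => hz.1)

end Gaussian

section StudentT

variable {μ σ ν : ℝ}

/-- The normalising constant of the Student t density. -/
noncomputable def studentTConst (σ ν : ℝ) : ℝ :=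
  Real.Gamma ((ν + 1) / 2) / (Real.Gamma (ν / 2) * Real.sqrt (ν * Real.pi) * σ)

theorem studentTConst_pos (hσ : 0 < σ) (hν : 0 < ν) : 0 < studentTConst σ ν := by
  have h1 := Real.Gamma_pos_of_pos (show 0 < (ν + 1) / 2 by positivity)
  have h2 := Real.Gamma_pos_of_pos (show 0 < ν / 2 by positivity)
  unfold studentTConst
  positivity

theorem studentT_eq (y : ℝ) : studentT μ σ ν y =
    studentTConst σ ν * (1 + ((y - μ) / σ) ^ 2 / ν) ^ (-((ν + 1) / 2)) := rfl

theorem measurable_studentT : Measurable (studentT μ σ ν) := by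
  unfold studentT
  fun_prop

theorem studentT_nonneg (hσ : 0 < σ) (hν : 0 < ν) (y : ℝ) : 0 ≤ studentT μ σ ν y := by
  have := studentTConst_pos hσ hν
  rw [studentT_eq]
  positivity

theorem studentT_le (hσ : 0 < σ) (hν : 0 < ν) (y : ℝ) :
    studentT μ σ ν y ≤ studentTConst σ ν := by
  rw [studentT_eq]
  refine mul_le_of_le_one_right (studentTConst_pos hσ hν).le ?_
  exact Real.rpow_le_one_of_one_le_of_nonpos (le_add_of_nonneg_right (by positivity))
    (neg_nonpos.2 (by positivity))

theorem hasGaussianLowerBound_studentT (hσ : 0 < σ) (hν : 0 < ν) :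
    HasGaussianLowerBound (studentT μ σ ν) := by
  refine ((HasGaussianLowerBound.const (studentTConst_pos hσ hν)).mul
    (.exp_neg_sq μ (b := (σ ^ 2 * ν)⁻¹ * ((ν + 1) / 2)) (by positivity))).mono fun y => ?_
  rw [studentT_eq]
  refine mul_le_mul_of_nonneg_left ?_ (studentTConst_pos hσ hν).le
  have hx : 0 < 1 + ((y - μ) / σ) ^ 2 / ν := by positivity
  have hlog := Real.log_le_sub_one_of_pos hx
  rw [Real.rpow_def_of_pos hx, Real.exp_le_exp]
  have h2 : (σ ^ 2 * ν)⁻¹ * ((ν + 1) / 2) * (y - μ) ^ 2 =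
      (1 + ((y - μ) / σ) ^ 2 / ν - 1) * ((ν + 1) / 2) := by
    field_simp
    ring
  rw [h2, mul_neg]
  exact neg_le_neg (mul_le_mul_of_nonneg_right hlog (by positivity))

theorem integrable_one_add_sq_mul_studentT (hσ : 0 < σ) (hν : 2 < ν) :
    Integrable fun y => (1 + y ^ 2) * studentT μ σ ν y := by
  have hν0 : 0 < ν := by linarith
  have hbase : Integrable fun y : ℝ =>
      (1 + ((y - μ) / (σ * Real.sqrt ν)) ^ 2) ^ (-(ν - 1) / 2) := by
    have h := integrable_rpow_neg_one_add_norm_sq (E := ℝ) (μ := volume) (r := ν - 1)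
      (by simp; linarith)
    have h' := (h.comp_div (show σ * Real.sqrt ν ≠ 0 by positivity)).comp_sub_right μ
    simpa only [Real.norm_eq_abs, sq_abs] using h'
  set A : ℝ := 1 + 2 * μ ^ 2 + 2 * (σ ^ 2 * ν)
  refine (hbase.const_mul (studentTConst σ ν * A)).mono'
    (by have := measurable_studentT (μ := μ) (σ := σ) (ν := ν); fun_prop)
    (ae_of_all _ fun y => ?_)
  have hc := studentTConst_pos hσ hν0
  rw [Real.norm_of_nonneg (mul_nonneg (by positivity) (studentT_nonneg hσ hν0 y)), studentT_eq]
  have hx : ((y - μ) / σ) ^ 2 / ν = ((y - μ) / (σ * Real.sqrt ν)) ^ 2 := by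
    rw [div_pow, div_pow, mul_pow, Real.sq_sqrt hν0.le, div_div]
  rw [hx]
  set x : ℝ := ((y - μ) / (σ * Real.sqrt ν)) ^ 2 with hxdef
  have hx0 : 0 ≤ x := sq_nonneg _
  have hy : (y - μ) ^ 2 = (σ ^ 2 * ν) * x := by
    rw [← hx]
    field_simp
  have hbound : 1 + y ^ 2 ≤ A * (1 + x) := by
    have h1 : y ^ 2 ≤ 2 * (y - μ) ^ 2 + 2 * μ ^ 2 := by nlinarith [sq_nonneg (y - 2 * μ)]
    have h2 : 0 ≤ σ ^ 2 * ν := by positivity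
    have h3 := mul_nonneg (sq_nonneg μ) hx0
    nlinarith
  have hpow : (1 + x) ^ (-(ν - 1) / 2) = (1 + x) * (1 + x) ^ (-((ν + 1) / 2)) := by
    rw [← Real.rpow_one_add' (by positivity) (by linarith)]
    congr 1
    ring
  rw [hpow]
  calc (1 + y ^ 2) * (studentTConst σ ν * (1 + x) ^ (-((ν + 1) / 2)))
      ≤ A * (1 + x) * (studentTConst σ ν * (1 + x) ^ (-((ν + 1) / 2))) :=
        mul_le_mul_of_nonneg_right hbound (by positivity)
    _ = _ := by ring

end StudentT

/-- Multiplying by a factor of at most quadratic growth preserves integrability when the second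
moment is finite. -/
theorem MeasureTheory.Integrable.mul_of_abs_le_one_add_sq {f g : ℝ → ℝ} {A : ℝ}
    (hf : Integrable fun y => (1 + y ^ 2) * f y) (hf0 : ∀ y, 0 ≤ f y) (hfm : Measurable f)
    (hgm : Measurable g) (hg : ∀ y, |g y| ≤ A * (1 + y ^ 2)) :
    Integrable fun y => g y * f y := by
  refine (hf.const_mul A).mono' (hgm.mul hfm).aestronglyMeasurable (ae_of_all _ fun y => ?_)
  rw [norm_mul, Real.norm_eq_abs, Real.norm_of_nonneg (hf0 y), ← mul_assoc]
  exact mul_le_mul_of_nonneg_right (hg y) (hf0 y)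

/-- Example 3 (heavy tails): the entropy conditions of Theorem 1 hold when the true
density is a Student t mixture with ν > 2 degrees of freedom and the pool is Gaussian. -/
theorem student_t_mixture_entropy_conditions
    (M K : ℕ) (hM : 0 < M) (hK : 0 < K)
    (μ : Fin M → ℝ) (σ : Fin M → ℝ) (hσ : ∀ m, 0 < σ m)
    (μ₀ : Fin K → ℝ) (σ₀ : Fin K → ℝ) (hσ₀ : ∀ i, 0 < σ₀ i)
    (ν : ℝ) (hν : 2 < ν)
    (p : Fin K → ℝ) (hp : p ∈ stdSimplex ℝ (Fin K))
    (ωs : Fin M → ℝ) (hωs : ωs ∈ stdSimplex ℝ (Fin M)) (hωs_pos : ∀ m, 0 < ωs m) :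
    Integrable (fun y =>
      (|Real.log (∑ m, ωs m * gaussCdf (μ m) (σ m ^ 2) y)| +
        |Real.log (1 - ∑ m, ωs m * gaussCdf (μ m) (σ m ^ 2) y)|) *
        ∑ i, p i * studentT (μ₀ i) (σ₀ i) ν y) ∧
    Integrable (fun y => (∑ i, p i * studentT (μ₀ i) (σ₀ i) ν y) *
      Real.log ((∑ i, p i * studentT (μ₀ i) (σ₀ i) ν y) /
        ∑ m, ωs m * gaussDensity (μ m) (σ m ^ 2) y)) := by
  have hν0 : 0 < ν := by linarith
  have hσ2 : ∀ m, 0 < σ m ^ 2 := fun m => pow_pos (hσ m) 2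
  set f : ℝ → ℝ := fun y => ∑ i, p i * studentT (μ₀ i) (σ₀ i) ν y with hf
  set h : ℝ → ℝ := fun y => ∑ m, ωs m * gaussDensity (μ m) (σ m ^ 2) y with hh
  set H : ℝ → ℝ := fun y => ∑ m, ωs m * gaussCdf (μ m) (σ m ^ 2) y with hH
  have hH1 : ∀ y, 1 - H y = ∑ m, ωs m * (1 - gaussCdf (μ m) (σ m ^ 2) y) := fun y => by
    simp only [hH, mul_sub, mul_one, Finset.sum_sub_distrib, hωs.2]
  obtain ⟨j, hj⟩ : ∃ j, 0 < p j := by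
    by_contra! hle
    have := Finset.sum_nonpos fun i (_ : i ∈ Finset.univ) => hle i
    linarith [hp.2]
  have hfm : Measurable f :=
    Finset.measurable_fun_sum _ fun i _ => measurable_studentT.const_mul _
  have hhm : Measurable h :=
    Finset.measurable_fun_sum _ fun m _ => measurable_gaussDensity.const_mul _
  have hHm : Measurable H :=
    Finset.measurable_fun_sum _ fun m _ => (measurable_gaussCdf (hσ2 m).le).const_mul _
  have hflow : HasGaussianLowerBound f :=
    .weighted_sum hp.1 (fun i => studentT_nonneg (hσ₀ i) hν0) hj
      (hasGaussianLowerBound_studentT (hσ₀ j) hν0)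
  have hhlow : HasGaussianLowerBound h :=
    .weighted_sum hωs.1 (fun _ => gaussDensity_nonneg) (hωs_pos ⟨0, hM⟩)
      (hasGaussianLowerBound_gaussDensity (hσ2 _))
  have hHlow : HasGaussianLowerBound H :=
    .weighted_sum hωs.1 (fun _ => gaussCdf_nonneg) (hωs_pos ⟨0, hM⟩)
      (hasGaussianLowerBound_gaussCdf (hσ2 _))
  have hH1low : HasGaussianLowerBound fun y => 1 - H y := by
    simp only [hH1]
    exact .weighted_sum hωs.1 (g := fun m y => 1 - gaussCdf (μ m) (σ m ^ 2) y)
      (fun m y => sub_nonneg.2 (gaussCdf_le_one (hσ2 m) y))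
      (hωs_pos ⟨0, hM⟩) (hasGaussianLowerBound_one_sub_gaussCdf (hσ2 _))
  obtain ⟨Af, hAf⟩ := hflow.exists_abs_log_le (B := ∑ i, p i * studentTConst (σ₀ i) ν) fun y =>
    Finset.sum_le_sum fun i _ => mul_le_mul_of_nonneg_left (studentT_le (hσ₀ i) hν0 y) (hp.1 i)
  obtain ⟨Ah, hAh⟩ := hhlow.exists_abs_log_le fun y =>
    Finset.sum_le_sum fun m _ =>
      mul_le_mul_of_nonneg_left (gaussDensity_le (hσ2 m).le y) (hωs.1 m)
  obtain ⟨AH, hAH⟩ := hHlow.exists_abs_log_le (B := 1) fun y => by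
    linarith [hH1low.pos y]
  obtain ⟨AH1, hAH1⟩ := hH1low.exists_abs_log_le (B := 1) fun y => by
    linarith [hHlow.pos y]
  have hfint : Integrable fun y => (1 + y ^ 2) * f y := by
    simp only [hf, Finset.mul_sum]
    refine integrable_finsetSum _ fun i _ => ?_
    simpa only [mul_left_comm] using
      (integrable_one_add_sq_mul_studentT (μ := μ₀ i) (hσ₀ i) hν).const_mul (p i)
  constructor
  · refine hfint.mul_of_abs_le_one_add_sq (A := AH + AH1) (fun y => (hflow.pos y).le) hfm
      (g := fun y => |Real.log (H y)| + |Real.log (1 - H y)|) (by fun_prop) fun y => ?_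
    rw [abs_of_nonneg (by positivity)]
    linarith [hAH y, hAH1 y]
  · simp only [mul_comm (Finset.sum _ _) (Real.log _)]
    refine hfint.mul_of_abs_le_one_add_sq (A := Af + Ah) (fun y => (hflow.pos y).le) hfm
      (g := fun y => Real.log (f y / h y)) (by fun_prop) fun y => ?_
    rw [Real.log_div (hflow.pos y).ne' (hhlow.pos y).ne']
    linarith [abs_sub (Real.log (f y)) (Real.log (h y)), hAf y, hAh y]
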